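/- arXiv:2311.12554 — 4 statements merged into one kernel-verified Lean document; each statement's English description precedes it below -/
import Mathlib

section
/- Let K ≥ 1 be an integer, let 1 ≤ m ≤ K−1, let N ≥ 1 be an integer, let f : [0,1] → ℝ have quantized tensor representation T on D_K, and let ε > 0. If E_{m,N}[f] ≤ ε, then the (ε,∞) rank of the m-th unfolding matrix of T satisfies r_m^{(ε,∞)}[T] ≤ N + 1. -/
noncomputable section

/-- The Chebyshev–Lobatto node `c_N^α = (cos(πα/N)+1)/2`, shifted and scaled to `[0,1]`. -/
def chebNode (N α : ℕ) : ℝ := (Real.cos (Real.pi * α / N) + 1) / 2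

/-- The Lagrange cardinal polynomial `P_N^α` for the Chebyshev–Lobatto grid:
the unique polynomial of degree at most `N` with `P_N^α (c_N^β) = δ^{αβ}`. -/
def chebP (N α : ℕ) (x : ℝ) : ℝ :=
  ∏ β ∈ (Finset.range (N + 1)).erase α,
    (x - chebNode N β) / (chebNode N α - chebNode N β)

/-- The real value of a bit. -/
def bitVal (b : Bool) : ℝ := if b then 1 else 0

/-- The quantized tensor representation of `f` on the dyadic grid `D_K`:
`T(σ_{1:K}) = f(Σ_{k=1}^K 2^{-k} σ_k)`. -/
def qtt (f : ℝ → ℝ) (K : ℕ) (σ : Fin K → Bool) : ℝ :=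
  f (∑ k : Fin K, (2 : ℝ) ^ (-(k.val + 1 : ℤ)) * bitVal (σ k))

/-- The `(ε,∞)` rank of the `m`-th unfolding matrix of the tensor `T : {0,1}^K → ℝ`:
the smallest `r` such that there exist `T_L^α : {0,1}^m → ℝ` and `T_R^α : {0,1}^{K-m} → ℝ`,
`α = 0,…,r-1`, with `|T(σ) - Σ_α T_L^α(σ_{1:m}) T_R^α(σ_{m+1:K})| ≤ ε` for all `σ`. -/
def epsRank (K m : ℕ) (hm : m ≤ K) (T : (Fin K → Bool) → ℝ) (ε : ℝ) : ℕ :=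
  sInf { r : ℕ |
    ∃ TL : Fin r → (Fin m → Bool) → ℝ, ∃ TR : Fin r → (Fin (K - m) → Bool) → ℝ,
      ∀ σ : Fin K → Bool,
        |T σ - ∑ α : Fin r, TL α (fun i => σ (Fin.castLE hm i)) *
            TR α (fun i => σ (Fin.cast (Nat.add_sub_cancel' hm) (Fin.natAdd m i)))| ≤ ε }

/-- The number in `[0,1)` with binary digits `σ`. -/
def dyadicVal {n : ℕ} (σ : Fin n → Bool) : ℝ :=
  ∑ k : Fin n, (2 : ℝ) ^ (-(k.val + 1 : ℤ)) * bitVal (σ k)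

lemma bitVal_nonneg (b : Bool) : 0 ≤ bitVal b := by
  cases b <;> simp [bitVal]

lemma bitVal_le_one (b : Bool) : bitVal b ≤ 1 := by
  cases b <;> simp [bitVal]

lemma dyadicVal_nonneg {n : ℕ} (σ : Fin n → Bool) : 0 ≤ dyadicVal σ :=
  Finset.sum_nonneg fun _ _ => mul_nonneg (by positivity) (bitVal_nonneg _)

lemma sum_two_zpow_neg (n : ℕ) :
    ∑ k : Fin n, (2 : ℝ) ^ (-(k.val + 1 : ℤ)) = 1 - (2 : ℝ) ^ (-(n : ℤ)) := by
  induction n with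
  | zero => simp
  | succ n ih =>
    have h : (2 : ℝ) ^ (-(n : ℤ)) = 2 * (2 : ℝ) ^ (-(n + 1 : ℤ)) := by
      rw [← zpow_one_add₀ two_ne_zero]
      congr 1
      ring
    rw [Fin.sum_univ_castSucc]
    simp only [Fin.val_castSucc, Fin.val_last, ih, h]
    push_cast
    ring

lemma dyadicVal_le {n : ℕ} (σ : Fin n → Bool) : dyadicVal σ ≤ 1 - (2 : ℝ) ^ (-(n : ℤ)) := by
  rw [← sum_two_zpow_neg]
  exact Finset.sum_le_sum fun k _ =>
    mul_le_of_le_one_right (by positivity) (bitVal_le_one _)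

lemma dyadicVal_le_one {n : ℕ} (σ : Fin n → Bool) : dyadicVal σ ≤ 1 :=
  (dyadicVal_le σ).trans (sub_le_self _ (by positivity))

lemma dyadicVal_split {K m : ℕ} (hm : m ≤ K) (σ : Fin K → Bool) :
    dyadicVal σ = dyadicVal (fun i => σ (Fin.castLE hm i)) +
      (2 : ℝ) ^ (-(m : ℤ)) *
        dyadicVal (fun i => σ (Fin.cast (Nat.add_sub_cancel' hm) (Fin.natAdd m i))) := by
  obtain ⟨l, rfl⟩ := Nat.exists_eq_add_of_le hm
  simp only [dyadicVal]
  rw [← (finCongr (Nat.add_sub_cancel' hm)).sum_comp, Fin.sum_univ_add, Finset.mul_sum]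
  congr 1
  refine Finset.sum_congr rfl fun k _ => ?_
  rw [← mul_assoc, ← zpow_add₀ two_ne_zero]
  simp only [finCongr_apply, Fin.val_cast, Fin.val_natAdd]
  congr 2
  push_cast
  ring

/-- if `E_{m,N}[f] ≤ ε` then `r_m^{(ε,∞)}[T] ≤ N + 1`. -/
theorem stmt0 (K m N : ℕ) (hK : 1 ≤ K) (hm1 : 1 ≤ m) (hmK : m ≤ K - 1) (hN : 1 ≤ N)
    (f : ℝ → ℝ) (ε : ℝ) (hε : 0 < ε)
    (hE : ∀ u ∈ Set.Icc (0 : ℝ) (1 - (2 : ℝ) ^ (-(m : ℤ))), ∀ v ∈ Set.Icc (0 : ℝ) 1,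
      |f (u + (2 : ℝ) ^ (-(m : ℤ)) * v) -
        ∑ α ∈ Finset.range (N + 1),
          f (u + (2 : ℝ) ^ (-(m : ℤ)) * chebNode N α) * chebP N α v| ≤ ε) :
    epsRank K m (hmK.trans (Nat.sub_le K 1)) (qtt f K) ε ≤ N + 1 := by
  refine Nat.sInf_le ⟨fun α σ => f (dyadicVal σ + (2 : ℝ) ^ (-(m : ℤ)) * chebNode N α),
    fun α σ => chebP N α (dyadicVal σ), fun σ => ?_⟩
  have hm : m ≤ K := hmK.trans (Nat.sub_le K 1)
  have h := hE (dyadicVal fun i => σ (Fin.castLE hm i)) ⟨dyadicVal_nonneg _, dyadicVal_le _⟩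
    (dyadicVal fun i => σ (Fin.cast (Nat.add_sub_cancel' hm) (Fin.natAdd m i)))
    ⟨dyadicVal_nonneg _, dyadicVal_le_one _⟩
  rw [← dyadicVal_split hm σ, Finset.sum_range] at h
  exact h
end
end

section
/- Suppose f : [0,1] → ℝ is (p+1)-times differentiable with |f^{(p+1)}(x)| ≤ C for all x ∈ [0,1], where p ≥ 1 is an integer. Then for every integer m ≥ 1 and every integer N > p, the interpolation error satisfies E_{m,N}[f] ≤ (4C/π) · 2^{−m} / (p (N − p)^p). -/
noncomputable section

/-- The `k`-th Fourier coefficient of a `2π`-periodic function, as an integral over `[0, 2π]`. -/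
def expCoeff (G : ℝ → ℂ) (k : ℤ) : ℂ :=
  (1 / (2 * Real.pi) : ℂ) *
    ∫ x in (0 : ℝ)..(2 * Real.pi), Complex.exp (-(k * x * Complex.I)) * G x

theorem norm_exp_neg_int_mul_I (k : ℤ) (x : ℝ) :
    ‖Complex.exp (-(k * x * Complex.I))‖ = 1 := by
  have h : (-(k * x * Complex.I) : ℂ) = ((-(k * x) : ℝ) : ℂ) * Complex.I := by
    push_cast; ring
  rw [h, Complex.norm_exp_ofReal_mul_I]

theorem norm_expCoeff_le {G : ℝ → ℂ} {A : ℝ} (hG : ∀ x, ‖G x‖ ≤ A) (k : ℤ) :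
    ‖expCoeff G k‖ ≤ A := by
  have h2 : ‖∫ x in (0 : ℝ)..(2 * Real.pi), Complex.exp (-(k * x * Complex.I)) * G x‖
      ≤ A * |2 * Real.pi - 0| := by
    apply intervalIntegral.norm_integral_le_of_norm_le_const
    intro x _
    rw [norm_mul, norm_exp_neg_int_mul_I, one_mul]
    exact hG x
  have hpi := Real.pi_pos
  have h3 : ‖(1 / (2 * Real.pi) : ℂ)‖ = 1 / (2 * Real.pi) := by
    rw [norm_div, norm_mul, Complex.norm_real, Real.norm_of_nonneg hpi.le]
    simp
  rw [expCoeff, norm_mul, h3]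
  rw [sub_zero, abs_of_pos (by positivity)] at h2
  calc _ ≤ 1 / (2 * Real.pi) * (A * (2 * Real.pi)) := by gcongr
    _ = A := by field_simp

theorem expCoeff_eq_of_hasDerivAt {G G' : ℝ → ℂ} (hG : ∀ x, HasDerivAt G (G' x) x)
    (hper : G (2 * Real.pi) = G 0)
    (hint : IntervalIntegrable G' MeasureTheory.volume 0 (2 * Real.pi)) {k : ℤ} (hk : k ≠ 0) :
    expCoeff G k = 1 / (k * Complex.I) * expCoeff G' k := by
  have hk' : (k : ℂ) ≠ 0 := by exact_mod_cast hk
  have hu : ∀ x : ℝ, HasDerivAt (fun x : ℝ => Complex.exp (-(k * x * Complex.I)))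
      (Complex.exp (-(k * x * Complex.I)) * (-(k * Complex.I))) x := by
    intro x
    have h1 : HasDerivAt (fun x : ℝ => (-(k * x * Complex.I) : ℂ)) (-(k * Complex.I)) x := by
      have := (((Complex.ofRealCLM.hasDerivAt (x := x)).const_mul (k : ℂ)).mul_const
        Complex.I).fun_neg
      simpa using this
    exact h1.cexp
  have hcont : Continuous (fun x : ℝ => Complex.exp (-(k * x * Complex.I))) := by fun_prop
  have key := intervalIntegral.integral_mul_deriv_eq_deriv_mul
    (u := fun x : ℝ => Complex.exp (-(k * x * Complex.I))) (v := G)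
    (a := 0) (b := 2 * Real.pi)
    (fun x _ => hu x) (fun x _ => hG x)
    ((hcont.mul continuous_const).intervalIntegrable _ _) hint
  have he : Complex.exp (-(k * ((2 * Real.pi : ℝ) : ℂ) * Complex.I)) = 1 := by
    rw [Complex.exp_eq_one_iff]
    exact ⟨-k, by push_cast; ring⟩
  have h4 : ∫ x in (0 : ℝ)..(2 * Real.pi),
      Complex.exp (-(k * x * Complex.I)) * (-(k * Complex.I)) * G x =
      (-(k * Complex.I)) * ∫ x in (0 : ℝ)..(2 * Real.pi),
        Complex.exp (-(k * x * Complex.I)) * G x := by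
    rw [← intervalIntegral.integral_const_mul]
    congr 1; ext x; ring
  rw [h4] at key
  simp only [he, hper, Complex.ofReal_zero, mul_zero, zero_mul, neg_zero, Complex.exp_zero,
    sub_self, zero_sub, neg_mul, neg_neg] at key
  rw [expCoeff, expCoeff, key]
  have hkI : (k : ℂ) * Complex.I ≠ 0 := mul_ne_zero hk' Complex.I_ne_zero
  rw [mul_left_comm, ← mul_assoc (1 / (k * Complex.I)), one_div_mul_cancel hkI, one_mul]

theorem expCoeff_neg_sin_mul {H : ℝ → ℂ} (hH : Continuous H) (k : ℤ) :
    expCoeff (fun x => -(Real.sin x : ℂ) * H x) k =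
      -(1 / (2 * Complex.I)) * (expCoeff H (k - 1) - expCoeff H (k + 1)) := by
  have hc : ∀ j : ℤ, IntervalIntegrable
      (fun x : ℝ => Complex.exp (-(j * x * Complex.I)) * H x) MeasureTheory.volume 0
      (2 * Real.pi) :=
    fun j => Continuous.intervalIntegrable (by fun_prop) _ _
  rw [expCoeff, expCoeff, expCoeff, ← mul_sub, ← intervalIntegral.integral_sub (hc _) (hc _),
    mul_left_comm, ← intervalIntegral.integral_const_mul (-(1 / (2 * Complex.I)))]
  refine congrArg _ (intervalIntegral.integral_congr fun x _ => ?_)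
  have h1 : Complex.exp (-(((k - 1 : ℤ) : ℂ) * x * Complex.I)) =
      Complex.exp (-(k * x * Complex.I)) * Complex.exp (x * Complex.I) := by
    rw [← Complex.exp_add]; congr 1; push_cast; ring
  have h2 : Complex.exp (-(((k + 1 : ℤ) : ℂ) * x * Complex.I)) =
      Complex.exp (-(k * x * Complex.I)) * Complex.exp (-x * Complex.I) := by
    rw [← Complex.exp_add]; congr 1; push_cast; ring
  rw [h1, h2, Complex.ofReal_sin, Complex.sin]
  have hI : Complex.I / 2 = -(1 / (2 * Complex.I)) := by
    field_simp; simp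
  rw [mul_div_assoc, hI]
  ring

/-- Decay of the Fourier coefficients of `θ ↦ g (cos θ)`, where `G j` plays the role of
`θ ↦ g⁽ʲ⁾ (cos θ)`. -/
theorem norm_expCoeff_le_div_descFactorial {G : ℕ → ℝ → ℂ} {p : ℕ} {A : ℝ}
    (hderiv : ∀ j ≤ p, ∀ x, HasDerivAt (G j) (-(Real.sin x : ℂ) * G (j + 1) x) x)
    (hper : ∀ j, G j (2 * Real.pi) = G j 0) (hA : ∀ x, ‖G (p + 1) x‖ ≤ A) :
    ∀ j ≤ p, ∀ n : ℕ, j + 1 ≤ n → ∀ k : ℤ, n ≤ k.natAbs →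
      ‖expCoeff (G (p - j)) k‖ ≤ A / (n.descFactorial (j + 1) : ℝ) := by
  have hA0 : 0 ≤ A := (norm_nonneg _).trans (hA 0)
  intro j
  induction j with
  | zero =>
    intro _ n hn k hk
    have hk0 : k ≠ 0 := by rintro rfl; simp at hk; omega
    have hb : ∀ x, ‖-(Real.sin x : ℂ) * G (p + 1) x‖ ≤ A := by
      intro x
      rw [norm_mul, norm_neg, Complex.norm_real]
      calc _ ≤ 1 * A := by
            gcongr
            · exact Real.abs_sin_le_one x
            · exact hA x
        _ = A := one_mul A
    have hder : (fun x => -(Real.sin x : ℂ) * G (p + 1) x) = deriv (G p) := by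
      ext x; exact (hderiv p le_rfl x).deriv.symm
    have hint : IntervalIntegrable (fun x => -(Real.sin x : ℂ) * G (p + 1) x)
        MeasureTheory.volume 0 (2 * Real.pi) := by
      refine (intervalIntegrable_const (c := A)).mono_fun ?_ ?_
      · rw [hder]; exact (measurable_deriv _).aestronglyMeasurable
      · exact Filter.Eventually.of_forall fun x => (hb x).trans (le_abs_self A)
    rw [Nat.sub_zero, expCoeff_eq_of_hasDerivAt (hderiv p le_rfl) (hper p) hint hk0, norm_mul]
    have hle := norm_expCoeff_le hb k
    have hn0 : (0 : ℝ) < n := by exact_mod_cast hn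
    have hkn : (n : ℝ) ≤ |(k : ℝ)| := by
      rw [← Int.cast_abs, ← Int.natCast_natAbs]; exact_mod_cast hk
    simp only [norm_div, norm_one, norm_mul, Complex.norm_intCast, Complex.norm_I, mul_one,
      zero_add, Nat.descFactorial_one]
    calc _ ≤ 1 / (n : ℝ) * A := by gcongr
      _ = A / n := by ring
  | succ j ih =>
    intro hj n hn k hk
    have hk0 : k ≠ 0 := by rintro rfl; simp at hk; omega
    obtain ⟨n, rfl⟩ : ∃ n', n = n' + 1 := ⟨n - 1, by omega⟩
    have e : p - (j + 1) + 1 = p - j := by omega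
    have hd := hderiv (p - (j + 1)) (by omega)
    rw [e] at hd
    have hcont : Continuous (G (p - j)) :=
      continuous_iff_continuousAt.2 fun x => (hderiv (p - j) (by omega) x).continuousAt
    have hint : IntervalIntegrable (fun x => -(Real.sin x : ℂ) * G (p - j) x)
        MeasureTheory.volume 0 (2 * Real.pi) :=
      Continuous.intervalIntegrable (by fun_prop) _ _
    rw [expCoeff_eq_of_hasDerivAt hd (hper _) hint hk0, expCoeff_neg_sin_mul hcont]
    have h1 := ih (by omega) n (by omega) (k - 1) (by omega)
    have h2 := ih (by omega) n (by omega) (k + 1) (by omega)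
    have h3 := (norm_sub_le (expCoeff (G (p - j)) (k - 1)) (expCoeff (G (p - j)) (k + 1))).trans
      (add_le_add h1 h2)
    have hkn : ((n : ℝ) + 1) ≤ |(k : ℝ)| := by
      rw [← Int.cast_abs, ← Int.natCast_natAbs]; exact_mod_cast hk
    have hn0 : (0 : ℝ) < (n : ℝ) + 1 := by positivity
    simp only [norm_div, norm_one, norm_mul, norm_neg, Complex.norm_intCast, Complex.norm_I,
      mul_one, Complex.norm_ofNat]
    rw [Nat.succ_descFactorial_succ]
    push_cast
    have hD : (0 : ℝ) < n.descFactorial (j + 1) := by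
      exact_mod_cast Nat.descFactorial_pos.2 (by omega)
    calc _ ≤ 1 / ((n : ℝ) + 1) * (1 / 2 * (A / (n.descFactorial (j + 1) : ℝ) +
            A / (n.descFactorial (j + 1) : ℝ))) := by gcongr
      _ = _ := by field_simp; ring

theorem exists_cos_alias {N : ℕ} (hN : 0 < N) (k : ℤ) :
    ∃ j : ℕ, j ≤ N ∧ ∀ α : ℕ,
      Real.cos (k * (Real.pi * α / N)) = Real.cos ((j : ℤ) * (Real.pi * α / N)) := by
  have hN' : (N : ℝ) ≠ 0 := by positivity
  have hmod := Int.emod_add_mul_ediv k (2 * N)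
  have h0 := Int.emod_nonneg k (b := 2 * N) (by omega)
  have h1 := Int.emod_lt_of_pos k (b := 2 * N) (by omega)
  set r := k % (2 * N)
  set q := k / (2 * N)
  have hk : (k : ℝ) = r + 2 * N * q := by rw [← hmod]; push_cast; ring
  have hr : ∀ α : ℕ, Real.cos (k * (Real.pi * α / N)) = Real.cos (r * (Real.pi * α / N)) := by
    intro α
    rw [← Real.cos_add_int_mul_two_pi (r * (Real.pi * α / N)) (q * α), hk]
    congr 1; push_cast; field_simp
  by_cases hle : r ≤ N
  · refine ⟨r.toNat, by omega, fun α => ?_⟩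
    rw [hr, Int.toNat_of_nonneg h0]
  · refine ⟨(2 * N - r).toNat, by omega, fun α => ?_⟩
    rw [hr, Int.toNat_of_nonneg (by omega), ← Real.cos_neg,
      ← Real.cos_add_int_mul_two_pi (-(r * (Real.pi * α / N))) α]
    congr 1; push_cast; field_simp; ring

theorem chebNode_injOn {N : ℕ} (hN : 0 < N) :
    Set.InjOn (chebNode N) (Finset.range (N + 1) : Finset ℕ) := by
  have hN' : (0 : ℝ) < N := by positivity
  have hmem : ∀ a ∈ (Finset.range (N + 1) : Finset ℕ),
      Real.pi * a / N ∈ Set.Icc 0 Real.pi := by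
    intro a ha
    have : (a : ℝ) ≤ N := by exact_mod_cast Nat.lt_succ_iff.1 (Finset.mem_range.1 ha)
    refine ⟨by have := Real.pi_pos; positivity, ?_⟩
    rw [div_le_iff₀ hN']
    exact mul_le_mul_of_nonneg_left this Real.pi_pos.le
  intro a ha b hb hab
  have h := Real.injOn_cos (hmem a ha) (hmem b hb) (by unfold chebNode at hab; linarith)
  have hpi := Real.pi_pos
  field_simp at h
  exact_mod_cast h

theorem eval_lagrangeBasis_chebNode (N α : ℕ) (v : ℝ) :
    (Lagrange.basis (Finset.range (N + 1)) (chebNode N) α).eval v = chebP N α v := by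
  rw [Lagrange.basis, Polynomial.eval_prod, chebP]
  refine Finset.prod_congr rfl fun β _ => ?_
  simp [Lagrange.basisDivisor, div_eq_inv_mul]

theorem sum_eval_mul_chebP {N : ℕ} (hN : 0 < N) {P : Polynomial ℝ} (hP : P.natDegree ≤ N)
    (v : ℝ) :
    ∑ α ∈ Finset.range (N + 1), P.eval (chebNode N α) * chebP N α v = P.eval v := by
  have hdeg : P.degree < (Finset.range (N + 1)).card := by
    rw [Finset.card_range]
    exact Polynomial.degree_le_natDegree.trans_lt (by exact_mod_cast Nat.lt_succ_of_le hP)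
  conv_rhs => rw [Lagrange.eq_interpolate (chebNode_injOn hN) hdeg]
  rw [Lagrange.interpolate_apply, Polynomial.eval_finsetSum]
  refine Finset.sum_congr rfl fun α _ => ?_
  rw [Polynomial.eval_mul, Polynomial.eval_C, eval_lagrangeBasis_chebNode]

theorem sum_cos_mul_chebP {N : ℕ} (hN : 0 < N) {j : ℕ} (hj : j ≤ N) {v θ : ℝ}
    (hv : v = (Real.cos θ + 1) / 2) :
    ∑ α ∈ Finset.range (N + 1), Real.cos ((j : ℤ) * (Real.pi * α / N)) * chebP N α v =
      Real.cos ((j : ℤ) * θ) := by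
  let L : Polynomial ℝ := Polynomial.C 2 * Polynomial.X - Polynomial.C 1
  have hL : L.natDegree ≤ 1 := by simp only [L]; compute_degree
  have hdeg : ((Polynomial.Chebyshev.T ℝ j).comp L).natDegree ≤ N := by
    refine Polynomial.natDegree_comp_le.trans ?_
    rw [Polynomial.Chebyshev.natDegree_T]
    simp only [Int.natAbs_natCast]
    nlinarith
  have hev : ∀ φ : ℝ, ((Polynomial.Chebyshev.T ℝ j).comp L).eval ((Real.cos φ + 1) / 2) =
      Real.cos ((j : ℤ) * φ) := by
    intro φ
    rw [← Polynomial.Chebyshev.T_real_cos, Polynomial.eval_comp]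
    congr 1
    simp [L]
    ring
  have := sum_eval_mul_chebP hN hdeg v
  rw [hv, hev] at this
  rw [← this, hv]
  refine Finset.sum_congr rfl fun α _ => ?_
  rw [chebNode, hev]

/-- The interpolation error of the `k`-th Chebyshev polynomial vanishes for `|k| ≤ N` and is at
most `2` otherwise, by aliasing. -/
theorem abs_cos_sub_sum_chebP_le {N : ℕ} (hN : 0 < N) (k : ℤ) {v θ : ℝ}
    (hv : v = (Real.cos θ + 1) / 2) :
    |Real.cos (k * θ) -
      ∑ α ∈ Finset.range (N + 1), Real.cos (k * (Real.pi * α / N)) * chebP N α v| ≤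
      if k.natAbs ≤ N then 0 else 2 := by
  split_ifs with hk
  · have habs : ∀ x : ℝ, Real.cos (k * x) = Real.cos (((k.natAbs : ℕ) : ℤ) * x) := by
      intro x
      rcases Int.natAbs_eq k with h | h
      · rw [← h]
      · rw [← Real.cos_neg]; congr 1; conv_lhs => rw [h]
        push_cast; ring
    simp only [habs]
    rw [sum_cos_mul_chebP hN hk hv, sub_self, abs_zero]
  · obtain ⟨j, hj, hcos⟩ := exists_cos_alias hN k
    simp only [hcos]
    rw [sum_cos_mul_chebP hN hj hv]
    refine (abs_sub _ _).trans ?_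
    linarith [Real.abs_cos_le_one (k * θ), Real.abs_cos_le_one ((j : ℤ) * θ)]

theorem one_div_descFactorial_succ {p n : ℕ} (hp : 1 ≤ p) (hn : p ≤ n) :
    (1 : ℝ) / ((n + 1).descFactorial (p + 1) : ℝ) =
      1 / p * (1 / (n.descFactorial p : ℝ) - 1 / ((n + 1).descFactorial p : ℝ)) := by
  have h1 : ((n + 1).descFactorial (p + 1) : ℝ) = (n + 1) * n.descFactorial p := by
    rw [Nat.succ_descFactorial_succ]; push_cast; ring
  have h2 : ((n + 1).descFactorial (p + 1) : ℝ) = (n + 1 - p) * (n + 1).descFactorial p := by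
    rw [Nat.descFactorial_succ, Nat.cast_mul, Nat.cast_sub (by omega)]; push_cast; ring
  have d1 : (0 : ℝ) < n.descFactorial p := by exact_mod_cast Nat.descFactorial_pos.2 hn
  have d2 : (0 : ℝ) < (n + 1).descFactorial p := by
    exact_mod_cast Nat.descFactorial_pos.2 (by omega)
  have hp' : (0 : ℝ) < p := by exact_mod_cast hp
  rw [h1]
  rw [h1] at h2
  field_simp
  linarith

theorem hasSum_one_div_descFactorial {p N : ℕ} (hp : 1 ≤ p) (hN : p ≤ N) :
    HasSum (fun n : ℕ => if n ≤ N then 0 else (1 : ℝ) / (n.descFactorial (p + 1) : ℝ))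
      (1 / p * (1 / (N.descFactorial p : ℝ))) := by
  have hz : ∑ i ∈ Finset.range (N + 1),
      (if i ≤ N then 0 else (1 : ℝ) / (i.descFactorial (p + 1) : ℝ)) = 0 := by
    refine Finset.sum_eq_zero fun i hi => ?_
    rw [if_pos (Nat.lt_succ_iff.1 (Finset.mem_range.1 hi))]
  rw [← hasSum_nat_add_iff' (N + 1), hz, sub_zero,
    hasSum_iff_tendsto_nat_of_nonneg (by intro i; split_ifs <;> positivity)]
  have hsum : ∀ M : ℕ, ∑ i ∈ Finset.range M, (if i + (N + 1) ≤ N then 0 else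
      (1 : ℝ) / ((i + (N + 1)).descFactorial (p + 1) : ℝ)) =
      1 / p * (1 / (N.descFactorial p : ℝ) - 1 / ((M + N).descFactorial p : ℝ)) := by
    intro M
    induction M with
    | zero => simp
    | succ M ih =>
      rw [Finset.sum_range_succ, ih, if_neg (by omega), ← add_assoc,
        one_div_descFactorial_succ hp (by omega), show M + 1 + N = M + N + 1 by ring]
      ring
  simp only [hsum]
  have hlim : Filter.Tendsto (fun M : ℕ => (1 : ℝ) / ((M + N).descFactorial p : ℝ))
      Filter.atTop (nhds 0) := by
    refine squeeze_zero (fun M => by positivity) (fun M => ?_)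
      tendsto_one_div_add_atTop_nhds_zero_nat
    have hle : M + 1 ≤ (M + N).descFactorial p := by
      refine le_trans ?_ (Nat.pow_sub_le_descFactorial (M + N) p)
      exact (show M + 1 ≤ M + N + 1 - p by omega).trans (Nat.le_self_pow (by omega) _)
    have hle' : (M : ℝ) + 1 ≤ (M + N).descFactorial p := by exact_mod_cast hle
    exact one_div_le_one_div_of_le (by positivity) hle'
  simpa using (hlim.const_sub (1 / (N.descFactorial p : ℝ))).const_mul (1 / (p : ℝ))

theorem hasSum_int_one_div_descFactorial {p N : ℕ} (hp : 1 ≤ p) (hN : p ≤ N) :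
    HasSum (fun k : ℤ => if k.natAbs ≤ N then 0 else
      (1 : ℝ) / (k.natAbs.descFactorial (p + 1) : ℝ))
      (2 / (p * (N.descFactorial p : ℝ))) := by
  have h := hasSum_one_div_descFactorial hp hN
  have hsum := HasSum.of_nat_of_neg (f := fun k : ℤ => if k.natAbs ≤ N then 0 else
      (1 : ℝ) / (k.natAbs.descFactorial (p + 1) : ℝ)) (by simpa using h) (by simpa using h)
  have hval : 1 / (p : ℝ) * (1 / (N.descFactorial p : ℝ)) +
      1 / (p : ℝ) * (1 / (N.descFactorial p : ℝ)) - 0 = 2 / (p * (N.descFactorial p : ℝ)) := by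
    ring
  rw [← hval]
  simpa using hsum

/-- A continuous `2π`-periodic function that factors through `cos` and has summable Fourier
coefficients is the sum of its cosine series. -/
theorem hasSum_expCoeff_mul_cos {g : ℝ → ℂ} (hg : Continuous fun θ => g (Real.cos θ))
    (hs : Summable (expCoeff fun θ => g (Real.cos θ))) (θ : ℝ) :
    HasSum (fun k : ℤ => expCoeff (fun θ => g (Real.cos θ)) k * (Real.cos (k * θ) : ℂ))
      (g (Real.cos θ)) := by
  have : Fact (0 < 2 * Real.pi) := ⟨Real.two_pi_pos⟩
  have hper : Function.Periodic (fun θ => g (Real.cos θ)) (2 * Real.pi) := fun x => by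
    simp only [Real.cos_add_two_pi]
  let Φ : C(AddCircle (2 * Real.pi), ℂ) :=
    ⟨hper.lift, continuous_quot_lift _ hg⟩
  have hΦ : ∀ x : ℝ, Φ (x : AddCircle (2 * Real.pi)) = g (Real.cos x) := fun x =>
    hper.lift_coe x
  have hfour : ∀ (k : ℤ) (x : ℝ), fourier k (x : AddCircle (2 * Real.pi)) =
      Complex.exp (k * x * Complex.I) := by
    intro k x
    rw [fourier_coe_apply]
    congr 1
    have := Real.pi_ne_zero
    push_cast
    field_simp
  have hcoef : fourierCoeff Φ = expCoeff fun θ => g (Real.cos θ) := by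
    ext k
    rw [fourierCoeff_eq_intervalIntegral Φ k 0, expCoeff]
    simp only [hΦ, hfour, zero_add, smul_eq_mul, Complex.real_smul]
    push_cast
    simp only [neg_mul]
  have hsum := has_pointwise_sum_fourier_series_of_summable (f := Φ) (by rw [hcoef]; exact hs)
  have h1 := hsum (θ : ℝ)
  have h2 := hsum ((-θ : ℝ) : AddCircle (2 * Real.pi))
  rw [hΦ] at h1 h2
  rw [Real.cos_neg] at h2
  have h3 := (h1.add h2).mul_left (1 / 2)
  have hval : 1 / 2 * (g (Real.cos θ) + g (Real.cos θ)) = g (Real.cos θ) := by ring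
  rw [hval] at h3
  refine (congrArg (fun φ => HasSum φ (g (Real.cos θ))) (funext fun k => ?_)).mpr h3
  rw [hcoef, hfour, hfour, Complex.ofReal_cos, Complex.cos]
  push_cast
  simp only [smul_eq_mul]
  ring_nf

/-- Chebyshev interpolation error of `g` for data whose cosine coefficients decay like
`A / (k (k - 1) ⋯ (k - p))`. -/
theorem abs_sub_sum_chebP_le {g : ℝ → ℝ} {p N : ℕ} {A : ℝ} (hp : 1 ≤ p) (hN : p < N)
    (hg : Continuous fun θ => (g (Real.cos θ) : ℂ))
    (hcoef : ∀ k : ℤ, p + 1 ≤ k.natAbs → ‖expCoeff (fun θ => (g (Real.cos θ) : ℂ)) k‖ ≤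
      A / (k.natAbs.descFactorial (p + 1) : ℝ)) {v θ : ℝ} (hv : v = (Real.cos θ + 1) / 2) :
    |g (Real.cos θ) -
      ∑ α ∈ Finset.range (N + 1), g (Real.cos (Real.pi * α / N)) * chebP N α v| ≤
      4 * A / (p * (N.descFactorial p : ℝ)) := by
  have hb := hasSum_int_one_div_descFactorial hp hN.le
  have hs : Summable (expCoeff fun θ => (g (Real.cos θ) : ℂ)) := by
    refine Summable.of_norm_bounded_eventually (hb.mul_left A).summable ?_
    have hfin : {k : ℤ | k.natAbs ≤ N}.Finite :=
      (Set.finite_Icc (-(N : ℤ)) N).subset fun k hk => by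
        simp only [Set.mem_ofPred_eq] at hk
        exact ⟨by omega, by omega⟩
    filter_upwards [hfin.compl_mem_cofinite] with k hk
    simp only [Set.mem_compl_iff, Set.mem_ofPred_eq] at hk
    rw [if_neg hk, mul_one_div]
    exact hcoef k (by omega)
  have hcos := hasSum_expCoeff_mul_cos (g := fun x => (g x : ℂ)) hg hs
  have herr := (hcos θ).sub (hasSum_sum (s := Finset.range (N + 1)) fun α _ =>
    (hcos (Real.pi * α / N)).mul_right (chebP N α v : ℂ))
  have hbound := herr.norm_le_of_bounded (hb.mul_left (2 * A)) fun k => ?_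
  · rw [← Real.norm_eq_abs, ← Complex.norm_real]
    push_cast
    refine hbound.trans (le_of_eq ?_)
    ring
  · have hE := abs_cos_sub_sum_chebP_le (show 0 < N by omega) k hv
    have hfac : expCoeff (fun θ => (g (Real.cos θ) : ℂ)) k * (Real.cos (k * θ) : ℂ) -
        ∑ α ∈ Finset.range (N + 1), expCoeff (fun θ => (g (Real.cos θ) : ℂ)) k *
          (Real.cos (k * (Real.pi * α / N)) : ℂ) * (chebP N α v : ℂ) =
        expCoeff (fun θ => (g (Real.cos θ) : ℂ)) k * ((Real.cos (k * θ) -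
          ∑ α ∈ Finset.range (N + 1),
            Real.cos (k * (Real.pi * α / N)) * chebP N α v : ℝ) : ℂ) := by
      push_cast
      rw [mul_sub, Finset.mul_sum]
      simp only [mul_assoc]
    rw [hfac, norm_mul, Complex.norm_real, Real.norm_eq_abs]
    split_ifs at hE ⊢ with hk
    · rw [le_antisymm hE (abs_nonneg _)]; simp
    · calc _ ≤ A / (k.natAbs.descFactorial (p + 1) : ℝ) * 2 := by
            have := hcoef k (by omega)
            gcongr
            exact (norm_nonneg _).trans this
        _ = _ := by ring

/-- if `f : [0,1] → ℝ` is `(p+1)`-times differentiable with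
`|f^{(p+1)}| ≤ C` on `[0,1]` and `p ≥ 1`, then for all `m ≥ 1` and `N > p`,
`E_{m,N}[f] ≤ (4C/π)·2^{-m}/(p(N-p)^p)`, where `E_{m,N}[f]` is expressed as the
pointwise bound over all `u ∈ [0,1-2^{-m}]`, `v ∈ [0,1]`. -/
theorem stmt1 (f : ℝ → ℝ) (p : ℕ) (hp : 1 ≤ p) (C : ℝ)
    (hdiff : ∀ i ≤ p,
      DifferentiableOn ℝ (iteratedDerivWithin i f (Set.Icc (0 : ℝ) 1)) (Set.Icc (0 : ℝ) 1))
    (hC : ∀ x ∈ Set.Icc (0 : ℝ) 1, |iteratedDerivWithin (p + 1) f (Set.Icc (0 : ℝ) 1) x| ≤ C)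
    (m N : ℕ) (hm : 1 ≤ m) (hN : p < N) :
    ∀ u ∈ Set.Icc (0 : ℝ) (1 - (2 : ℝ) ^ (-(m : ℤ))), ∀ v ∈ Set.Icc (0 : ℝ) 1,
      |f (u + (2 : ℝ) ^ (-(m : ℤ)) * v) -
        ∑ α ∈ Finset.range (N + 1),
          f (u + (2 : ℝ) ^ (-(m : ℤ)) * chebNode N α) * chebP N α v|
        ≤ (4 * C / Real.pi) * (2 : ℝ) ^ (-(m : ℤ)) / (p * ((N : ℝ) - p) ^ p) := by
  intro u hu v hv
  set h : ℝ := (2 : ℝ) ^ (-(m : ℤ))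
  have hpos : 0 < h := by positivity
  have hhalf : h ≤ 1 / 2 := by
    have : h ≤ (2 : ℝ) ^ (-1 : ℤ) := zpow_le_zpow_right₀ (by norm_num) (by omega)
    norm_num at this ⊢
    exact this
  let F : ℕ → ℝ → ℝ := fun j => iteratedDerivWithin j f (Set.Icc (0 : ℝ) 1)
  let pt : ℝ → ℝ := fun x => u + h * ((x + 1) / 2)
  have hpt : ∀ θ, pt (Real.cos θ) ∈ Set.Icc (0 : ℝ) 1 := by
    intro θ
    have h1 := Real.neg_one_le_cos θ
    have h2 := Real.cos_le_one θ
    have h3 : h * ((Real.cos θ + 1) / 2) ≤ h * 1 := by gcongr; linarith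
    have h4 : 0 ≤ h * ((Real.cos θ + 1) / 2) := mul_nonneg hpos.le (by linarith)
    exact ⟨add_nonneg hu.1 h4, by simp only [pt]; linarith [hu.2]⟩
  have hptd : ∀ θ, HasDerivAt (fun θ => pt (Real.cos θ)) (-Real.sin θ * (h / 2)) θ := by
    intro θ
    have := ((((Real.hasDerivAt_cos θ).add_const 1).div_const 2).const_mul h).const_add u
    exact this.congr_deriv (by ring)
  let G : ℕ → ℝ → ℂ := fun j θ => (((h / 2) ^ j * F j (pt (Real.cos θ)) : ℝ) : ℂ)
  have hderiv : ∀ j ≤ p, ∀ θ, HasDerivAt (G j) (-(Real.sin θ : ℂ) * G (j + 1) θ) θ := by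
    intro j hj θ
    have h1 : HasDerivWithinAt (F j) (F (j + 1) (pt (Real.cos θ))) (Set.Icc 0 1)
        (pt (Real.cos θ)) := by
      have := (hdiff j hj _ (hpt θ)).hasDerivWithinAt
      rwa [← iteratedDerivWithin_succ] at this
    have h2 := ((h1.comp_hasDerivAt θ (hptd θ) (Filter.Eventually.of_forall hpt)).const_mul
      ((h / 2) ^ j)).ofReal_comp
    refine h2.congr_deriv ?_
    simp only [G]
    push_cast
    ring
  have hA : ∀ θ, ‖G (p + 1) θ‖ ≤ (h / 2) ^ (p + 1) * C := by
    intro θ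
    simp only [G]
    rw [Complex.norm_real, norm_mul, Real.norm_of_nonneg (by positivity), Real.norm_eq_abs]
    exact mul_le_mul_of_nonneg_left (hC _ (hpt θ)) (by positivity)
  have hper : ∀ j, G j (2 * Real.pi) = G j 0 := by
    intro j
    simp only [G, Real.cos_two_pi, Real.cos_zero]
  have hG0 : G 0 = fun θ => ((fun x => f (pt x)) (Real.cos θ) : ℂ) := by
    ext θ
    simp [G, F]
  have hdecay := norm_expCoeff_le_div_descFactorial hderiv hper hA p le_rfl
  rw [Nat.sub_self, hG0] at hdecay
  have hcont : Continuous (G 0) :=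
    continuous_iff_continuousAt.2 fun θ => (hderiv 0 (Nat.zero_le p) θ).continuousAt
  rw [hG0] at hcont
  have hv' : v = (Real.cos (Real.arccos (2 * v - 1)) + 1) / 2 := by
    rw [Real.cos_arccos (by linarith [hv.1]) (by linarith [hv.2])]
    ring
  have herr := abs_sub_sum_chebP_le (g := fun x => f (pt x)) hp hN hcont
    (fun k hk => hdecay _ hk k le_rfl) hv'
  simp only [pt] at herr
  rw [← hv'] at herr
  refine herr.trans ?_
  have hC0 : 0 ≤ C := (abs_nonneg _).trans (hC 0 (by simp))
  have hp0 : (0 : ℝ) < p := by exact_mod_cast hp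
  have hNp : (0 : ℝ) < (N : ℝ) - p := sub_pos.2 (by exact_mod_cast hN)
  have hdf : ((N : ℝ) - p) ^ p ≤ (N.descFactorial p : ℝ) := by
    calc ((N : ℝ) - p) ^ p = (((N - p) ^ p : ℕ) : ℝ) := by
          rw [Nat.cast_pow, Nat.cast_sub hN.le]
      _ ≤ _ := by
          exact_mod_cast (Nat.pow_le_pow_left (by omega) p).trans
            (Nat.pow_sub_le_descFactorial N p)
  have hpow : (h / 2) ^ (p + 1) ≤ h / Real.pi := by
    calc (h / 2) ^ (p + 1) ≤ (h / 2) ^ 2 :=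
          pow_le_pow_of_le_one (by positivity) (by linarith) (by omega)
      _ ≤ h / 4 := by nlinarith
      _ ≤ h / Real.pi := by
          have := Real.pi_le_four
          have := Real.pi_pos
          gcongr
  calc 4 * ((h / 2) ^ (p + 1) * C) / (p * (N.descFactorial p : ℝ))
      ≤ 4 * (h / Real.pi * C) / (p * ((N : ℝ) - p) ^ p) := by gcongr
    _ = _ := by ring
end
end

section
/- Suppose f : [0,1] → ℝ is the restriction to [0,1] of an Ω-bandlimited function with spectral measure μ. Let K > m ≥ 1 be integers, let T be the quantized tensor representation of f on D_K, and let ε > 0. Then the (ε,∞) rank of the m-th unfolding matrix of T satisfies r_m^{(ε,∞)}[T] ≤ 1 + ⌈2^{−m}Ω + 2 log₊(2|μ|/(πε))⌉, where log₊(x) := max(log x, 0). -/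
noncomputable section

/-- The total variation `|μ|` of a finite signed measure. -/
def tv (μ : MeasureTheory.SignedMeasure ℝ) : ℝ :=
  (μ.totalVariation Set.univ).toReal

/-- The integral of a complex-valued function against a signed measure, via the
Jordan decomposition `μ = μ⁺ - μ⁻`. -/
def sintegral (μ : MeasureTheory.SignedMeasure ℝ) (g : ℝ → ℂ) : ℂ :=
  (∫ ω, g ω ∂μ.toJordanDecomposition.posPart) -
    ∫ ω, g ω ∂μ.toJordanDecomposition.negPart

/-- `g : ℝ → ℝ` is `Ω`-bandlimited with spectral measure `μ`. -/
def IsBandlimited (Ω : ℝ) (μ : MeasureTheory.SignedMeasure ℝ) (g : ℝ → ℝ) : Prop :=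
  μ.totalVariation (Set.Icc (-Ω) Ω)ᶜ = 0 ∧
    ∀ x : ℝ, (g x : ℂ) =
      (1 / (2 * (Real.pi : ℂ))) *
        sintegral μ (fun ω => Complex.exp (Complex.I * (ω : ℂ) * (x : ℂ)))

/-- Iterated Rolle: if `F k` has derivative `F (k + 1)` for all `k` and `F 0` has `n + 1` zeros, then
`F n` has a zero. -/
theorem exists_eq_zero_of_strictMono_zeros (n : ℕ) : ∀ (F : ℕ → ℝ → ℝ) (x : ℕ → ℝ),
    (∀ k t, HasDerivAt (F k) (F (k + 1) t) t) → (∀ i < n, x i < x (i + 1)) →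
    (∀ i ≤ n, F 0 (x i) = 0) → ∃ ξ, F n ξ = 0 := by
  induction n with
  | zero => exact fun F x _ _ h => ⟨x 0, h 0 le_rfl⟩
  | succ n ih =>
    intro F x hF hx h0
    have key : ∀ i, ∃ y, i ≤ n → x i < y ∧ y < x (i + 1) ∧ F 1 y = 0 := by
      intro i
      by_cases hi : i ≤ n
      · obtain ⟨y, hy, hy'⟩ := exists_hasDerivAt_eq_zero (hx i (by lia))
          (fun t _ => (hF 0 t).continuousAt.continuousWithinAt)
          ((h0 i (by lia)).trans (h0 (i + 1) (by lia)).symm) (fun t _ => hF 0 t)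
        exact ⟨y, fun _ => ⟨hy.1, hy.2, hy'⟩⟩
      · exact ⟨0, fun h => absurd h hi⟩
    choose y hy using key
    exact ih (fun k => F (k + 1)) y (fun k t => hF (k + 1) t)
      (fun i hi => (hy i (by lia)).2.1.trans (hy (i + 1) (by lia)).1)
      (fun i hi => (hy i hi).2.2)

theorem exists_eq_zero_of_card_zeros {n : ℕ} {F : ℕ → ℝ → ℝ} {s : Finset ℝ}
    (hF : ∀ k t, HasDerivAt (F k) (F (k + 1) t) t) (hs : s.card = n + 1)
    (h0 : ∀ v ∈ s, F 0 v = 0) : ∃ ξ, F n ξ = 0 := by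
  let e := s.orderEmbOfFin hs
  refine exists_eq_zero_of_strictMono_zeros n F
    (fun i => if h : i < n + 1 then e ⟨i, h⟩ else 0) hF (fun i hi => ?_) (fun i hi => ?_)
  · have h1 : i < n + 1 := by lia
    have h2 : i + 1 < n + 1 := by lia
    simp only [h1, h2, dif_pos]
    exact e.strictMono (by simp)
  · have h1 : i < n + 1 := by lia
    simp only [h1, dif_pos]
    exact h0 _ (s.orderEmbOfFin_mem hs _)

open Polynomial in
/-- The remainder estimate for Lagrange interpolation at the nodes `s`. -/
theorem abs_sub_interpolate_le {n : ℕ} {F : ℕ → ℝ → ℝ} {s : Finset ℝ} {M : ℝ}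
    (hF : ∀ k t, HasDerivAt (F k) (F (k + 1) t) t) (hs : s.card = n)
    (hM : ∀ t, |F n t| ≤ M) (x : ℝ) :
    |F 0 x - (Lagrange.interpolate s id (F 0)).eval x| ≤
      M * |(Lagrange.nodal s id).eval x| / n.factorial := by
  have hM0 : 0 ≤ M := (abs_nonneg _).trans (hM 0)
  have hinj : Set.InjOn (id : ℝ → ℝ) s := Function.injective_id.injOn
  set P := Lagrange.interpolate s id (F 0) with hP
  set w := Lagrange.nodal s (id : ℝ → ℝ) with hw
  have hPv : ∀ v ∈ s, P.eval v = F 0 v := fun v hv =>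
    Lagrange.eval_interpolate_at_node (v := id) (F 0) hinj hv
  have hwv : ∀ v ∈ s, w.eval v = 0 := fun v hv =>
    Lagrange.eval_nodal_at_node (v := id) hv
  by_cases hx : x ∈ s
  · rw [hPv x hx, sub_self, abs_zero]
    positivity
  have hwx : w.eval x ≠ 0 :=
    Lagrange.eval_nodal_not_at_node (v := id) fun i hi h => hx (by rw [h]; exact hi)
  set c := (F 0 x - P.eval x) / w.eval x with hc
  set Q := P + C c * w with hQ
  have hcard : (insert x s).card = n + 1 := by rw [Finset.card_insert_of_notMem hx, hs]
  obtain ⟨ξ, hξ⟩ := exists_eq_zero_of_card_zeros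
    (F := fun k t => F k t - (derivative^[k] Q).eval t)
    (fun k t => by
      rw [Function.iterate_succ_apply']
      exact (hF k t).sub (Polynomial.hasDerivAt _ t)) hcard (by
    intro v hv
    rcases Finset.mem_insert.1 hv with rfl | hv
    · simp [hQ, hc, hwx]
    · simp [hQ, hPv v hv, hwv v hv])
  have hPd : derivative^[n] P = 0 := by
    apply Polynomial.iterate_derivative_eq_zero_of_degree_lt
    rw [← hs]
    exact Lagrange.degree_interpolate_lt _ hinj
  have hwd : derivative^[n] w = C (n.factorial : ℝ) := by
    have h1 : w.natDegree = n := by rw [hw, Lagrange.natDegree_nodal, hs]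
    have h2 : w.leadingCoeff = 1 := (Lagrange.nodal_monic (s := s) (v := id))
    rw [Polynomial.eq_C_of_natDegree_le_zero (p := derivative^[n] w)
      ((Polynomial.natDegree_iterate_derivative w n).trans (by lia)),
      Polynomial.coeff_iterate_derivative, zero_add, Nat.descFactorial_self]
    rw [Polynomial.leadingCoeff, h1] at h2
    simp [h2]
  have hcn : F n ξ = c * n.factorial := by
    have : (derivative^[n] Q).eval ξ = c * n.factorial := by
      simp [hQ, Polynomial.iterate_derivative_C_mul, hPd, hwd]
    linarith
  have hfac : (0 : ℝ) < n.factorial := by positivity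
  have hE : F 0 x - P.eval x = c * w.eval x := by rw [hc]; field_simp
  rw [hE, abs_mul, le_div_iff₀ hfac]
  have := hM ξ
  rw [hcn, abs_mul, abs_of_pos hfac] at this
  nlinarith [abs_nonneg (w.eval x)]

open Polynomial in
/-- The Chebyshev nodes: `n` points whose nodal polynomial is at most `2 / 2 ^ n` on `[-1, 1]`. -/
theorem exists_chebyshev_nodes {n : ℕ} (hn : n ≠ 0) : ∃ s : Finset ℝ, s.card = n ∧
    ∀ x : ℝ, |x| ≤ 1 → |(Lagrange.nodal s id).eval x| ≤ 2 / 2 ^ n := by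
  set s : Finset ℝ := (Finset.range n).image
    (fun k : ℕ => Real.cos ((2 * k + 1) * Real.pi / (2 * n))) with hsdef
  have hroots : (Chebyshev.T ℝ n).roots = s.val := Chebyshev.roots_T_real n
  have hs : s.card = n := by
    rw [hsdef, Finset.card_image_of_injOn, Finset.card_range]
    exact (Finset.range n).nodup_map_iff_injOn.mp (Chebyshev.roots_T_real_nodup n)
  have hprod : C ((2 : ℝ) ^ (n - 1)) * Lagrange.nodal s id = Chebyshev.T ℝ n := by
    have h := C_leadingCoeff_mul_prod_multiset_X_sub_C (p := Chebyshev.T ℝ n)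
      (by rw [hroots, Chebyshev.natDegree_T, Finset.card_val, hs, Int.natAbs_natCast])
    rwa [hroots, Chebyshev.leadingCoeff_T, Int.natAbs_natCast] at h
  refine ⟨s, hs, fun x hx => ?_⟩
  have h1 := Chebyshev.abs_eval_T_real_le_one n hx
  rw [← hprod, eval_mul, eval_C, abs_mul, abs_of_pos (by positivity)] at h1
  obtain ⟨k, rfl⟩ := Nat.exists_eq_succ_of_ne_zero hn
  rw [le_div_iff₀ (by positivity), pow_succ]
  rw [Nat.succ_sub_one] at h1
  linarith

/-- Interpolation of `exp (i A x)` at the nodes `s`. -/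
theorem norm_cexp_sub_interpolate_le {n : ℕ} {s : Finset ℝ} (hs : s.card = n) (A x : ℝ) :
    ‖Complex.exp (Complex.I * ((A * x : ℝ) : ℂ)) - ∑ v ∈ s,
        (((Lagrange.basis s id v).eval x : ℝ) : ℂ) * Complex.exp (Complex.I * ((A * v : ℝ) : ℂ))‖ ≤
      |A| ^ n * |(Lagrange.nodal s id).eval x| / n.factorial := by
  set E := Complex.exp (Complex.I * ((A * x : ℝ) : ℂ)) - ∑ v ∈ s,
    (((Lagrange.basis s id v).eval x : ℝ) : ℂ) * Complex.exp (Complex.I * ((A * v : ℝ) : ℂ)) with hE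
  set φ := -E.arg with hφ
  have hre : ∀ t : ℝ, (Complex.exp (Complex.I * φ) * Complex.exp (Complex.I * ((A * t : ℝ) : ℂ))).re
      = Real.cos (A * t + φ) := by
    intro t
    rw [← Complex.exp_add, ← Complex.exp_ofReal_mul_I_re]
    congr 2
    push_cast
    ring
  have hnorm : ‖E‖ = (Complex.exp (Complex.I * φ) * E).re := by
    have h := Complex.norm_mul_exp_arg_mul_I E
    conv_rhs => rw [← h]
    rw [mul_left_comm, ← Complex.exp_add, hφ]
    simp [mul_comm]
  have hsum : (Complex.exp (Complex.I * φ) * E).re = Real.cos (A * x + φ) -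
      (Lagrange.interpolate s id (fun t => Real.cos (A * t + φ))).eval x := by
    rw [hE, mul_sub, Complex.sub_re, hre, Finset.mul_sum, Complex.re_sum,
      Lagrange.interpolate_apply, Polynomial.eval_finsetSum]
    congr 1
    refine Finset.sum_congr rfl fun v _ => ?_
    rw [mul_left_comm, Complex.re_ofReal_mul, hre]
    simp [mul_comm]
  have hF : ∀ (k : ℕ) (t : ℝ), HasDerivAt
      (fun t => A ^ k * Real.cos (A * t + φ + k * (Real.pi / 2)))
      (A ^ (k + 1) * Real.cos (A * t + φ + (k + 1 : ℕ) * (Real.pi / 2))) t := by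
    intro k t
    have h1 : HasDerivAt (fun t : ℝ => A * t + φ + k * (Real.pi / 2)) A t := by
      simpa using (((hasDerivAt_id t).const_mul A).add_const φ).add_const (k * (Real.pi / 2))
    refine (h1.cos.const_mul (A ^ k)).congr_deriv ?_
    have : A * t + φ + (k + 1 : ℕ) * (Real.pi / 2) =
      A * t + φ + k * (Real.pi / 2) + Real.pi / 2 := by push_cast; ring
    rw [this, Real.cos_add_pi_div_two]
    ring
  have := abs_sub_interpolate_le
    (F := fun k t => A ^ k * Real.cos (A * t + φ + k * (Real.pi / 2))) (M := |A| ^ n) hF hs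
    (fun t => by
      rw [abs_mul, abs_pow]
      exact mul_le_of_le_one_right (by positivity) (Real.abs_cos_le_one _)) x
  rw [hnorm, hsum]
  refine (le_abs_self _).trans ?_
  simpa using this

open MeasureTheory in
theorem norm_sintegral_le {μ : SignedMeasure ℝ} {f : ℝ → ℂ} {C : ℝ}
    (hf : ∀ᵐ ω ∂μ.totalVariation, ‖f ω‖ ≤ C) : ‖sintegral μ f‖ ≤ C * tv μ := by
  rw [SignedMeasure.totalVariation, ae_add_measure_iff] at hf
  have h1 := norm_integral_le_of_norm_le_const hf.1
  have h2 := norm_integral_le_of_norm_le_const hf.2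
  have h3 : tv μ = μ.toJordanDecomposition.posPart.real Set.univ +
      μ.toJordanDecomposition.negPart.real Set.univ := by
    rw [← measureReal_add_apply]
    rfl
  rw [h3, mul_add]
  exact (norm_sub_le _ _).trans (add_le_add h1 h2)

open MeasureTheory in
theorem sintegral_sub_sum {ι : Type*} (s : Finset ι) (μ : SignedMeasure ℝ) (c : ι → ℂ)
    {f : ℝ → ℂ} {F : ι → ℝ → ℂ}
    (hf : ∀ (ν : Measure ℝ) [IsFiniteMeasure ν], Integrable f ν)
    (hF : ∀ i ∈ s, ∀ (ν : Measure ℝ) [IsFiniteMeasure ν], Integrable (F i) ν) :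
    sintegral μ f - ∑ i ∈ s, c i * sintegral μ (F i) =
      sintegral μ (fun ω => f ω - ∑ i ∈ s, c i * F i ω) := by
  have key : ∀ (ν : Measure ℝ) [IsFiniteMeasure ν], ∫ ω, (f ω - ∑ i ∈ s, c i * F i ω) ∂ν =
      ∫ ω, f ω ∂ν - ∑ i ∈ s, c i * ∫ ω, F i ω ∂ν := by
    intro ν _
    rw [integral_sub (hf ν) (integrable_finsetSum _ fun i hi => (hF i hi ν).const_mul _),
      integral_finsetSum _ fun i hi => (hF i hi ν).const_mul _]
    simp_rw [integral_const_mul]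
  simp only [sintegral, key, mul_sub, Finset.sum_sub_distrib]
  ring

open MeasureTheory in
theorem integrable_cexp_I_mul (ν : Measure ℝ) [IsFiniteMeasure ν] (x : ℝ) :
    Integrable (fun ω : ℝ => Complex.exp (Complex.I * (ω : ℂ) * (x : ℂ))) ν := by
  refine Integrable.of_bound (C := 1) (by fun_prop) (.of_forall fun ω => ?_)
  rw [mul_assoc, mul_comm, ← Complex.ofReal_mul, Complex.norm_exp_ofReal_mul_I]

open MeasureTheory in
/-- Interpolation of a bandlimited function at Chebyshev nodes transported to the interval of
centre `b` and radius `r`. -/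
theorem IsBandlimited.abs_sub_interpolate_le {Ω : ℝ} {μ : SignedMeasure ℝ} {g : ℝ → ℝ}
    (hg : IsBandlimited Ω μ g) {n : ℕ} {s : Finset ℝ} (hs : s.card = n) {b r x : ℝ} (hr : 0 ≤ r)
    (hx : |(Lagrange.nodal s id).eval x| ≤ 2 / 2 ^ n) :
    |g (b + r * x) - ∑ v ∈ s, (Lagrange.basis s id v).eval x * g (b + r * v)| ≤
      tv μ / Real.pi * ((Ω * r / 2) ^ n / n.factorial) := by
  have hae : ∀ᵐ ω ∂μ.totalVariation, |ω| ≤ Ω := by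
    refine measure_mono_null (fun ω hω => ?_) hg.1
    exact fun h => hω (abs_le.2 h)
  have hE : ∀ᵐ ω : ℝ ∂μ.totalVariation,
      ‖Complex.exp (Complex.I * (ω : ℂ) * ((b + r * x : ℝ) : ℂ)) - ∑ v ∈ s,
        (((Lagrange.basis s id v).eval x : ℝ) : ℂ) *
          Complex.exp (Complex.I * (ω : ℂ) * ((b + r * v : ℝ) : ℂ))‖ ≤
        2 * ((Ω * r / 2) ^ n / n.factorial) := by
    filter_upwards [hae] with ω hω
    have hfac : ∀ t : ℝ, Complex.exp (Complex.I * (ω : ℂ) * ((b + r * t : ℝ) : ℂ)) =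
        Complex.exp (Complex.I * ((ω * b : ℝ) : ℂ)) *
          Complex.exp (Complex.I * (((ω * r) * t : ℝ) : ℂ)) := by
      intro t
      rw [← Complex.exp_add]
      congr 1
      push_cast
      ring
    simp_rw [hfac, mul_left_comm _ (Complex.exp (Complex.I * ((ω * b : ℝ) : ℂ)))]
    rw [← Finset.mul_sum, ← mul_sub, norm_mul, mul_comm Complex.I ((ω * b : ℝ) : ℂ),
      Complex.norm_exp_ofReal_mul_I, one_mul]
    refine (norm_cexp_sub_interpolate_le hs (ω * r) x).trans ?_
    have h1 : |ω * r| ≤ Ω * r := by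
      rw [abs_mul, abs_of_nonneg hr]
      gcongr
    have h2 : 0 ≤ Ω * r := (abs_nonneg _).trans h1
    calc |ω * r| ^ n * |(Lagrange.nodal s id).eval x| / n.factorial
        ≤ (Ω * r) ^ n * (2 / 2 ^ n) / n.factorial := by gcongr
      _ = 2 * ((Ω * r / 2) ^ n / n.factorial) := by rw [div_pow]; ring
  have hnorm := norm_sintegral_le hE
  rw [← sintegral_sub_sum s μ _ (fun ν _ => integrable_cexp_I_mul ν _)
    (fun i _ ν _ => integrable_cexp_I_mul ν _)] at hnorm
  have hcast : ((g (b + r * x) - ∑ v ∈ s, (Lagrange.basis s id v).eval x * g (b + r * v) : ℝ) : ℂ) =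
      (1 / (2 * (Real.pi : ℂ))) *
      (sintegral μ (fun ω => Complex.exp (Complex.I * (ω : ℂ) * ((b + r * x : ℝ) : ℂ))) -
        ∑ v ∈ s, (((Lagrange.basis s id v).eval x : ℝ) : ℂ) *
          sintegral μ (fun ω => Complex.exp (Complex.I * (ω : ℂ) * ((b + r * v : ℝ) : ℂ)))) := by
    rw [Complex.ofReal_sub, Complex.ofReal_sum, mul_sub, ← hg.2, Finset.mul_sum]
    congr 1
    refine Finset.sum_congr rfl fun v _ => ?_
    rw [Complex.ofReal_mul, hg.2]
    ring
  rw [← Real.norm_eq_abs, ← Complex.norm_real, hcast, norm_mul]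
  have hpi : ‖(1 / (2 * (Real.pi : ℂ)))‖ = 1 / (2 * Real.pi) := by
    simp [abs_of_pos Real.pi_pos]
  rw [hpi]
  calc 1 / (2 * Real.pi) * _ ≤ 1 / (2 * Real.pi) * (2 * ((Ω * r / 2) ^ n / n.factorial) * tv μ) :=
        mul_le_mul_of_nonneg_left hnorm (by have := Real.pi_pos; positivity)
    _ = _ := by field_simp

theorem interpolation_error_le {V ε y : ℝ} (hε : 0 < ε) (hy : 0 ≤ y) {n : ℕ}
    (hn : y + 2 * max (Real.log (2 * V / (Real.pi * ε))) 0 ≤ n) :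
    V / Real.pi * ((y / 4) ^ n / n.factorial) ≤ ε := by
  have hpi := Real.pi_pos
  set L := max (Real.log (2 * V / (Real.pi * ε))) 0 with hL
  have hL0 : 0 ≤ L := le_max_right _ _
  have hVL : 2 * V / (Real.pi * ε) ≤ Real.exp L :=
    (Real.le_exp_log _).trans (Real.exp_le_exp.2 (le_max_left _ _))
  have hV' : V / Real.pi ≤ ε * Real.exp L / 2 := by
    rw [div_le_iff₀ (by positivity)] at hVL ⊢
    linarith
  have hpow : (y / 4) ^ n / n.factorial ≤ Real.exp (-L) := by
    have h1 := Real.pow_div_factorial_le_exp (x := Real.exp 1 * (y / 4)) (by positivity) n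
    rw [mul_pow, mul_div_assoc, ← Real.exp_nat_mul, mul_one] at h1
    have h2 : Real.exp 1 * (y / 4) ≤ -L + n := by
      have := Real.exp_one_lt_d9
      nlinarith
    have h3 := h1.trans (Real.exp_le_exp.2 h2)
    rw [Real.exp_add, mul_comm] at h3
    exact le_of_mul_le_mul_right h3 (Real.exp_pos _)
  calc V / Real.pi * ((y / 4) ^ n / n.factorial)
      ≤ (ε * Real.exp L / 2) * Real.exp (-L) := by gcongr
    _ = ε / 2 := by rw [Real.exp_neg]; field_simp
    _ ≤ ε := by linarith

theorem sum_binary_digits_mem_Icc (m n : ℕ) (b : Fin n → Bool) :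
    ∑ j : Fin n, (2 : ℝ) ^ (-((m + j.val : ℕ) + 1 : ℤ)) * bitVal (b j) ∈
      Set.Icc (0 : ℝ) (2 ^ (-(m : ℤ))) := by
  have hb : ∀ c, 0 ≤ bitVal c ∧ bitVal c ≤ 1 := by
    rintro (_ | _) <;> simp [bitVal]
  have hgeom : ∀ k : ℕ, ∑ j ∈ Finset.range k, (2 : ℝ) ^ (-((m + j : ℕ) + 1 : ℤ)) =
      2 ^ (-(m : ℤ)) * (1 - 2 ^ (-(k : ℤ))) := by
    intro k
    induction k with
    | zero => simp
    | succ k ih =>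
      rw [Finset.sum_range_succ, ih]
      push_cast
      simp only [neg_add, zpow_add₀ (two_ne_zero' ℝ), zpow_neg_one]
      ring
  refine ⟨Finset.sum_nonneg fun j _ => mul_nonneg (by positivity) (hb _).1, ?_⟩
  calc _ ≤ ∑ j : Fin n, (2 : ℝ) ^ (-((m + j.val : ℕ) + 1 : ℤ)) :=
        Finset.sum_le_sum fun j _ => mul_le_of_le_one_right (by positivity) (hb _).2
    _ = 2 ^ (-(m : ℤ)) * (1 - 2 ^ (-(n : ℤ))) := by
        rw [Fin.sum_univ_eq_sum_range (fun j => (2 : ℝ) ^ (-((m + j : ℕ) + 1 : ℤ))), hgeom]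
    _ ≤ _ := mul_le_of_le_one_right (by positivity) (by
        have : (0 : ℝ) < 2 ^ (-(n : ℤ)) := by positivity
        linarith)

theorem sum_binary_digits_split {K m : ℕ} (hm : m ≤ K) (σ : Fin K → Bool) :
    ∑ k : Fin K, (2 : ℝ) ^ (-(k.val + 1 : ℤ)) * bitVal (σ k) =
      ∑ i : Fin m, (2 : ℝ) ^ (-(i.val + 1 : ℤ)) * bitVal (σ (Fin.castLE hm i)) +
      ∑ j : Fin (K - m), (2 : ℝ) ^ (-((m + j.val : ℕ) + 1 : ℤ)) *
        bitVal (σ (Fin.cast (Nat.add_sub_cancel' hm) (Fin.natAdd m j))) := by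
  rw [← Equiv.sum_comp (finCongr (Nat.add_sub_cancel' hm)), Fin.sum_univ_add]
  rfl

/-- if `f : [0,1] → ℝ` is the restriction of an `Ω`-bandlimited function
with spectral measure `μ`, `K > m ≥ 1`, `T` the quantized tensor representation of `f`
on `D_K`, and `ε > 0`, then `r_m^{(ε,∞)}[T] ≤ 1 + ⌈2^{-m}Ω + 2 log₊(2|μ|/(πε))⌉`. -/
theorem stmt6 (Ω : ℝ) (hΩ : 0 < Ω) (μ : MeasureTheory.SignedMeasure ℝ) (g : ℝ → ℝ)
    (hg : IsBandlimited Ω μ g) (K m : ℕ) (hm1 : 1 ≤ m) (hmK : m < K)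
    (ε : ℝ) (hε : 0 < ε) :
    epsRank K m hmK.le (qtt g K) ε ≤
      1 + ⌈(2 : ℝ) ^ (-(m : ℤ)) * Ω +
        2 * max (Real.log (2 * tv μ / (Real.pi * ε))) 0⌉₊ := by
  refine Nat.sInf_le ?_
  set n := 1 + ⌈(2 : ℝ) ^ (-(m : ℤ)) * Ω +
    2 * max (Real.log (2 * tv μ / (Real.pi * ε))) 0⌉₊ with hn
  obtain ⟨s, hs, hnodal⟩ := exists_chebyshev_nodes (n := n) (by lia)
  set h : ℝ := 2 ^ (-(m : ℤ)) with hh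
  have hpos : 0 < h := by positivity
  let e : Fin n ≃ s := (s.equivFinOfCardEq hs).symm
  refine ⟨fun α τ => g (∑ i : Fin m, (2 : ℝ) ^ (-(i.val + 1 : ℤ)) * bitVal (τ i) + h / 2 +
      h / 2 * (e α : ℝ)),
    fun α τ => (Lagrange.basis s id (e α : ℝ)).eval
      ((∑ j : Fin (K - m), (2 : ℝ) ^ (-((m + j.val : ℕ) + 1 : ℤ)) * bitVal (τ j)) / (h / 2) - 1),
    fun σ => ?_⟩
  rw [qtt, sum_binary_digits_split hmK.le]
  have ht := sum_binary_digits_mem_Icc m (K - m)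
    (fun j => σ (Fin.cast (Nat.add_sub_cancel' hmK.le) (Fin.natAdd m j)))
  set a := ∑ i : Fin m, (2 : ℝ) ^ (-(i.val + 1 : ℤ)) * bitVal (σ (Fin.castLE hmK.le i))
  set t := ∑ j : Fin (K - m), (2 : ℝ) ^ (-((m + j.val : ℕ) + 1 : ℤ)) *
    bitVal (σ (Fin.cast (Nat.add_sub_cancel' hmK.le) (Fin.natAdd m j)))
  set x := t / (h / 2) - 1 with hx
  have hxt : a + t = a + h / 2 + h / 2 * x := by rw [hx]; field_simp; ring
  have hx1 : |x| ≤ 1 := by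
    have h1 : 0 ≤ t / (h / 2) := div_nonneg ht.1 (by positivity)
    have h2 : t / (h / 2) ≤ 2 := by
      rw [div_le_iff₀ (by positivity)]
      linarith [ht.2]
    exact abs_le.2 ⟨by linarith, by linarith⟩
  have hsum : ∑ α : Fin n, g (a + h / 2 + h / 2 * (e α : ℝ)) *
      (Lagrange.basis s id (e α : ℝ)).eval x =
      ∑ v ∈ s, (Lagrange.basis s id v).eval x * g (a + h / 2 + h / 2 * v) := by
    rw [Equiv.sum_comp e (fun v : s => g (a + h / 2 + h / 2 * (v : ℝ)) *
      (Lagrange.basis s id (v : ℝ)).eval x),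
      Finset.sum_coe_sort s (fun v : ℝ => g (a + h / 2 + h / 2 * v) *
        (Lagrange.basis s id v).eval x)]
    exact Finset.sum_congr rfl fun v _ => mul_comm _ _
  rw [hsum, hxt]
  refine (hg.abs_sub_interpolate_le hs (by positivity) (hnodal x hx1)).trans ?_
  have hy : Ω * (h / 2) / 2 = h * Ω / 4 := by ring
  rw [hy]
  refine interpolation_error_le hε (by positivity) ?_
  rw [hn]
  push_cast
  linarith [Nat.le_ceil (h * Ω + 2 * max (Real.log (2 * tv μ / (Real.pi * ε))) 0)]
end
end

section
/- Let K ≥ 1 be an arbitrary integer, let f : [0,1] → ℝ be the restriction to [0,1] of an Ω-bandlimited function with spectral measure μ, let T be the quantized tensor representation of f on D_K, and let ε > 0. Then for every 1 ≤ m ≤ K−1, the (ε,∞) rank of the m-th unfolding matrix of T satisfies the uniform bound r_m^{(ε,∞)}[T] ≤ 1 + ⌈√Ω + 2 log₊(2|μ|/(πε))⌉, where log₊(x) := max(log x, 0). -/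
noncomputable section

section LagrangeChebyshev
open Polynomial
theorem exists_iteratedDeriv_eq_zero_of_strictMono (n : ℕ) (f : ℝ → ℝ) (hf : ContDiff ℝ n f)
    (x : Fin (n + 1) → ℝ) (hx : StrictMono x) (hfx : ∀ i, f (x i) = 0) :
    ∃ c, iteratedDeriv n f c = 0 := by
  induction n generalizing f with
  | zero => exact ⟨x 0, by simpa using hfx 0⟩
  | succ n ih =>
    have hroot (i : Fin (n + 1)) : ∃ c ∈ Set.Ioo (x i.castSucc) (x i.succ), deriv f c = 0 :=
      exists_deriv_eq_zero (hx i.castSucc_lt_succ) hf.continuous.continuousOn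
        ((hfx _).trans (hfx _).symm)
    choose y hy hfy using hroot
    obtain ⟨c, hc⟩ := ih (deriv f) (by
        have : ContDiff ℝ ((n : WithTop ℕ∞) + 1) f := by exact_mod_cast hf
        exact (contDiff_succ_iff_deriv.mp this).2.2) y
      (fun i j hij => (hy i).2.trans_le
        ((hx.monotone (by simpa [Fin.le_def] using Nat.succ_le_of_lt hij)).trans (hy j).1.le)) hfy
    exact ⟨c, by rwa [iteratedDeriv_succ']⟩

theorem Polynomial.iteratedDeriv_eval (P : ℝ[X]) (n : ℕ) :
    iteratedDeriv n (fun x => P.eval x) = fun x => (derivative^[n] P).eval x := by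
  induction n generalizing P with
  | zero => simp
  | succ n ih =>
    rw [iteratedDeriv_succ', Function.iterate_succ_apply, ← ih]
    congr 1
    ext x
    simp

theorem Polynomial.eval_iterate_derivative_of_natDegree_le {P : ℝ[X]} {n : ℕ}
    (hP : P.natDegree ≤ n) (x : ℝ) :
    (derivative^[n] P).eval x = n.factorial * P.coeff n := by
  have h := Polynomial.natDegree_iterate_derivative P n
  rw [Polynomial.eq_C_of_natDegree_le_zero (h.trans (by omega))]
  simp [Polynomial.coeff_iterate_derivative, Nat.descFactorial_self]

theorem abs_sub_sum_lagrange_basis_mul_factorial_le {n : ℕ} {f : ℝ → ℝ} (hf : ContDiff ℝ n f)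
    {M : ℝ} (hM : ∀ t, |iteratedDeriv n f t| ≤ M) {v : Fin n → ℝ} (hv : Function.Injective v)
    (x : ℝ) :
    |f x - ∑ i, f (v i) * (Lagrange.basis Finset.univ v i).eval x| * n.factorial ≤
      M * |∏ i, (x - v i)| := by
  set p := Lagrange.interpolate Finset.univ v (fun i => f (v i)) with hp
  set w := Lagrange.nodal Finset.univ v with hw
  have hpx : ∑ i, f (v i) * (Lagrange.basis Finset.univ v i).eval x = p.eval x := by
    simp [hp, Lagrange.interpolate_apply, eval_finsetSum]
  have hpv (i : Fin n) : p.eval (v i) = f (v i) :=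
    Lagrange.eval_interpolate_at_node _ hv.injOn (Finset.mem_univ i)
  have hwx : w.eval x = ∏ i, (x - v i) := Lagrange.eval_nodal
  rw [hpx, ← hwx]
  by_cases hxv : ∃ i, v i = x
  · obtain ⟨i, rfl⟩ := hxv
    simp [hpv, hw, Lagrange.eval_nodal_at_node]
  have hw0 : w.eval x ≠ 0 := by
    rw [hwx, Finset.prod_ne_zero_iff]
    exact fun i _ h => hxv ⟨i, by linarith⟩
  set c := (f x - p.eval x) / w.eval x with hc
  set P := p + C c * w with hP
  have hpdeg : p.degree < n := by
    have := Lagrange.degree_interpolate_lt (s := Finset.univ) (fun i => f (v i)) hv.injOn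
    rwa [Finset.card_univ, Fintype.card_fin] at this
  have hwdeg : w.natDegree = n := by simp [hw]
  have hPdeg : P.natDegree ≤ n := by
    refine natDegree_add_le_of_degree_le (natDegree_le_of_degree_le hpdeg.le) ?_
    exact (natDegree_C_mul_le _ _).trans hwdeg.le
  have hPcoeff : P.coeff n = c := by
    have h1 : w.coeff n = 1 := by
      have := Lagrange.nodal_monic (s := Finset.univ) (v := v)
      rwa [Monic, leadingCoeff, ← hw, hwdeg] at this
    simp [hP, coeff_eq_zero_of_degree_lt hpdeg, h1]
  have hcard : (insert x (Finset.univ.image v)).card = n + 1 := by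
    rw [Finset.card_insert_of_notMem (by simpa using hxv),
      Finset.card_image_of_injective _ hv, Finset.card_univ, Fintype.card_fin]
  have hPc : ContDiff ℝ n (fun t => P.eval t) := by
    simpa using P.contDiff_aeval (𝕜 := ℝ) n
  obtain ⟨ξ, hξ⟩ := exists_iteratedDeriv_eq_zero_of_strictMono n (fun t => f t - P.eval t)
    (hf.sub hPc) _ (Finset.orderEmbOfFin _ hcard).strictMono (fun i => by
      have := Finset.orderEmbOfFin_mem _ hcard i
      rcases Finset.mem_insert.mp this with h | h
      · rw [h]
        simp [hP, hc, hw0]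
      · obtain ⟨j, -, h⟩ := Finset.mem_image.mp h
        rw [← h]
        simp [hP, hpv, hw, Lagrange.eval_nodal_at_node])
  rw [iteratedDeriv_fun_sub hf.contDiffAt hPc.contDiffAt, iteratedDeriv_eval] at hξ
  beta_reduce at hξ
  rw [eval_iterate_derivative_of_natDegree_le hPdeg ξ, hPcoeff, sub_eq_zero] at hξ
  have hfx : f x - p.eval x = c * w.eval x := by rw [hc]; field_simp
  rw [hfx, abs_mul, mul_right_comm]
  gcongr
  have := hM ξ
  rwa [hξ, abs_mul, Nat.abs_cast, mul_comm] at this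

/-- The `i`-th root of the Chebyshev polynomial `T n`. -/
def chebyshevNode (n : ℕ) (i : Fin n) : ℝ := Real.cos ((2 * (i : ℕ) + 1) * Real.pi / (2 * n))

theorem chebyshevNode_injective (n : ℕ) : Function.Injective (chebyshevNode n) := by
  intro i j hij
  have := (Finset.range n).nodup_map_iff_injOn.mp (Chebyshev.roots_T_real_nodup n)
  exact Fin.ext (this (by simp) (by simp) hij)

theorem abs_prod_sub_chebyshevNode_le {n : ℕ} (hn : n ≠ 0) {u : ℝ} (hu : |u| ≤ 1) :
    |∏ i, (u - chebyshevNode n i)| ≤ 2 / 2 ^ n := by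
  have hinj := (Finset.range n).nodup_map_iff_injOn.mp (Chebyshev.roots_T_real_nodup n)
  have h := C_leadingCoeff_mul_prod_multiset_X_sub_C (p := Chebyshev.T ℝ n) (by
    rw [Chebyshev.roots_T_real, Finset.card_val, Finset.card_image_of_injOn hinj]
    simp)
  have h2 := congrArg (eval u) h
  have h3 := Chebyshev.abs_eval_T_real_le_one n hu
  rw [← h2, Chebyshev.roots_T_real, eval_mul, eval_C, Chebyshev.leadingCoeff_T,
    eval_multiset_prod, Multiset.map_map] at h3
  change |_ * ∏ i ∈ Finset.image _ _, _| ≤ 1 at h3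
  rw [Finset.prod_image hinj, Finset.prod_range, abs_mul] at h3
  obtain ⟨k, rfl⟩ := Nat.exists_eq_succ_of_ne_zero hn
  have hk : ((k.succ : ℕ) : ℤ).natAbs - 1 = k := by omega
  rw [hk, abs_pow, abs_two] at h3
  rw [pow_succ, div_mul_cancel_right₀ two_ne_zero, ← one_div, le_div_iff₀ (by positivity)]
  rw [mul_comm]
  simpa [chebyshevNode] using h3

theorem abs_cos_sub_chebyshev_interpolation_le {n : ℕ} (hn : n ≠ 0) {u : ℝ} (hu : |u| ≤ 1)
    {a A : ℝ} (ha : |a| ≤ A) (c : ℝ) :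
    |Real.cos (a * u + c) - ∑ i, Real.cos (a * chebyshevNode n i + c) *
      (Lagrange.basis Finset.univ (chebyshevNode n) i).eval u| ≤
      2 * (A / 2) ^ n / n.factorial := by
  have hA : 0 ≤ A := (abs_nonneg a).trans ha
  have hd : ∀ t, |iteratedDeriv n (fun t => Real.cos (a * t + c)) t| ≤ A ^ n := by
    intro t
    rw [iteratedDeriv_comp_const_mul (f := fun t => Real.cos (t + c)) (by fun_prop),
      iteratedDeriv_comp_add_const, abs_mul, abs_pow]
    calc _ ≤ A ^ n * 1 := by
          gcongr
          exact Real.abs_iteratedDeriv_cos_le_one _ _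
      _ = _ := mul_one _
  have h := abs_sub_sum_lagrange_basis_mul_factorial_le (n := n)
    (f := fun t => Real.cos (a * t + c)) (by fun_prop) hd (chebyshevNode_injective n) u
  rw [le_div_iff₀ (by positivity)]
  refine h.trans ?_
  calc _ ≤ A ^ n * (2 / 2 ^ n) := by gcongr; exact abs_prod_sub_chebyshevNode_le hn hu
    _ = _ := by rw [div_pow]; ring

end LagrangeChebyshev

theorem IsBandlimited.eq_integral_cos {Ω : ℝ} {μ : MeasureTheory.SignedMeasure ℝ} {g : ℝ → ℝ}
    (hg : IsBandlimited Ω μ g) (x : ℝ) :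
    g x = (1 / (2 * Real.pi)) * ((∫ ω, Real.cos (ω * x) ∂μ.toJordanDecomposition.posPart) -
      ∫ ω, Real.cos (ω * x) ∂μ.toJordanDecomposition.negPart) := by
  have hre (ν : MeasureTheory.Measure ℝ) [MeasureTheory.IsFiniteMeasure ν] :
      (∫ ω : ℝ, Complex.exp (Complex.I * ω * x) ∂ν).re = ∫ ω, Real.cos (ω * x) ∂ν := by
    have hexp (ω : ℝ) : Complex.exp (Complex.I * ω * x) =
        Complex.exp (((ω * x : ℝ) : ℂ) * Complex.I) := by
      push_cast
      ring_nf
    have hint : MeasureTheory.Integrable (fun ω : ℝ => Complex.exp (Complex.I * ω * x)) ν :=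
      MeasureTheory.Integrable.of_bound (by fun_prop) 1 (.of_forall fun ω => by
        rw [hexp, Complex.norm_exp_ofReal_mul_I])
    have h := integral_re hint
    simp only [RCLike.re_to_complex] at h
    rw [← h]
    refine MeasureTheory.integral_congr_ae (.of_forall fun ω => ?_)
    change (Complex.exp (Complex.I * ω * x)).re = _
    rw [hexp, Complex.exp_ofReal_mul_I_re]
  have h := congrArg Complex.re (hg.2 x)
  have hc : (1 / (2 * (Real.pi : ℂ))) = ((1 / (2 * Real.pi) : ℝ) : ℂ) := by push_cast; rfl
  rw [hc, Complex.re_ofReal_mul, Complex.ofReal_re, sintegral, Complex.sub_re, hre, hre] at h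
  exact h

theorem integrable_cos_mul (ν : MeasureTheory.Measure ℝ) [MeasureTheory.IsFiniteMeasure ν]
    (x : ℝ) : MeasureTheory.Integrable (fun ω => Real.cos (ω * x)) ν :=
  MeasureTheory.Integrable.of_bound (by fun_prop) 1
    (.of_forall fun ω => by simpa using Real.abs_cos_le_one _)

theorem tv_eq_add (μ : MeasureTheory.SignedMeasure ℝ) :
    tv μ = μ.toJordanDecomposition.posPart.real Set.univ +
      μ.toJordanDecomposition.negPart.real Set.univ := by
  rw [tv, MeasureTheory.SignedMeasure.totalVariation, MeasureTheory.Measure.add_apply,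
    ENNReal.toReal_add (by simp) (by simp)]
  rfl

theorem tv_nonneg (μ : MeasureTheory.SignedMeasure ℝ) : 0 ≤ tv μ := ENNReal.toReal_nonneg

/-- A linear quadrature rule that is accurate on every cosine of frequency at most `Ω` is accurate
on every `Ω`-bandlimited function. -/
theorem IsBandlimited.abs_sub_sum_le {Ω : ℝ} {μ : MeasureTheory.SignedMeasure ℝ} {g : ℝ → ℝ}
    (hg : IsBandlimited Ω μ g) {n : ℕ} (x : ℝ) (p c : Fin n → ℝ) {B : ℝ}
    (hB : ∀ ω, |ω| ≤ Ω → |Real.cos (ω * x) - ∑ i, Real.cos (ω * p i) * c i| ≤ B) :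
    |g x - ∑ i, g (p i) * c i| ≤ B * tv μ / (2 * Real.pi) := by
  have hint (ν : MeasureTheory.Measure ℝ) [MeasureTheory.IsFiniteMeasure ν] :
      ∫ ω, (Real.cos (ω * x) - ∑ i, Real.cos (ω * p i) * c i) ∂ν =
        (∫ ω, Real.cos (ω * x) ∂ν) - ∑ i, (∫ ω, Real.cos (ω * p i) ∂ν) * c i := by
    rw [MeasureTheory.integral_sub (integrable_cos_mul ν x)
      (MeasureTheory.integrable_finsetSum _ fun i _ => (integrable_cos_mul ν (p i)).mul_const _),
      MeasureTheory.integral_finsetSum _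
        fun i _ => (integrable_cos_mul ν (p i)).mul_const _]
    simp only [MeasureTheory.integral_mul_const]
  have hbound (ν : MeasureTheory.Measure ℝ) [MeasureTheory.IsFiniteMeasure ν]
      (hν : ν (Set.Icc (-Ω) Ω)ᶜ = 0) :
      |∫ ω, (Real.cos (ω * x) - ∑ i, Real.cos (ω * p i) * c i) ∂ν| ≤ B * ν.real Set.univ := by
    rw [← Real.norm_eq_abs]
    refine MeasureTheory.norm_integral_le_of_norm_le_const ?_
    filter_upwards [MeasureTheory.mem_ae_iff.mpr hν] with ω hω
    exact hB ω (abs_le.mpr hω)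
  have hsupp := hg.1
  rw [MeasureTheory.SignedMeasure.totalVariation, MeasureTheory.Measure.add_apply,
    add_eq_zero] at hsupp
  have hpos := hbound _ hsupp.1
  have hneg := hbound _ hsupp.2
  have key : g x - ∑ i, g (p i) * c i = (1 / (2 * Real.pi)) *
      ((∫ ω, (Real.cos (ω * x) - ∑ i, Real.cos (ω * p i) * c i)
          ∂μ.toJordanDecomposition.posPart) -
        ∫ ω, (Real.cos (ω * x) - ∑ i, Real.cos (ω * p i) * c i)
          ∂μ.toJordanDecomposition.negPart) := by
    rw [hint, hint]
    simp only [hg.eq_integral_cos, mul_assoc, ← Finset.mul_sum, sub_mul, Finset.sum_sub_distrib]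
    ring
  rw [key, abs_mul, abs_of_pos (by positivity), tv_eq_add, mul_comm, mul_one_div]
  gcongr
  rw [mul_add]
  exact (abs_sub _ _).trans (add_le_add hpos hneg)

theorem IsBandlimited.abs_sub_chebyshev_interpolation_le {Ω : ℝ}
    {μ : MeasureTheory.SignedMeasure ℝ} {g : ℝ → ℝ} (hg : IsBandlimited Ω μ g) {n : ℕ}
    (hn : n ≠ 0) (y : ℝ) {l u : ℝ} (hl : 0 ≤ l) (hu : |u| ≤ 1) :
    |g (y + l * (1 + u)) - ∑ i, g (y + l * (1 + chebyshevNode n i)) *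
      (Lagrange.basis Finset.univ (chebyshevNode n) i).eval u| ≤
      tv μ / Real.pi * (Ω * l / 2) ^ n / n.factorial := by
  refine (hg.abs_sub_sum_le _ (fun i => y + l * (1 + chebyshevNode n i)) _
    (B := 2 * (Ω * l / 2) ^ n / n.factorial) fun ω hω => ?_).trans_eq ?_
  · have hωl : |ω * l| ≤ Ω * l := by
      rw [abs_mul, abs_of_nonneg hl]
      gcongr
    have harg (t : ℝ) : ω * (y + l * (1 + t)) = ω * l * t + ω * (y + l) := by ring
    simp only [harg]
    exact abs_cos_sub_chebyshev_interpolation_le hn hu hωl _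
  · field_simp

theorem mul_pow_div_factorial_le {Ω t ε N : ℝ} {r : ℕ} (hΩ : 0 ≤ Ω) (ht : 0 ≤ t) (hε : 0 < ε)
    (hr : r ≠ 0) (hrN : r ≤ N)
    (h : Real.sqrt Ω + 2 * max (Real.log (2 * t / (Real.pi * ε))) 0 ≤ r) :
    t / Real.pi * (Ω / (4 * N)) ^ r / r.factorial ≤ ε := by
  set b := 2 * max (Real.log (2 * t / (Real.pi * ε))) 0 with hb
  have hb0 : 0 ≤ b := by positivity
  have hr0 : (0 : ℝ) < r := by positivity
  have hN0 : 0 < N := hr0.trans_le hrN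
  have ht' : t / Real.pi ≤ ε * Real.exp b := by
    rcases ht.eq_or_lt with rfl | ht0
    · simp only [zero_div]
      positivity
    have hlog : Real.log (2 * t / (Real.pi * ε)) ≤ b := by
      have h1 := le_max_left (Real.log (2 * t / (Real.pi * ε))) 0
      linarith [le_max_right (Real.log (2 * t / (Real.pi * ε))) 0]
    have h1 := (Real.log_le_iff_le_exp (by positivity)).mp hlog
    rw [div_le_iff₀ (by positivity)] at h1 ⊢
    nlinarith
  have hs : Real.sqrt Ω ≤ r * Real.exp (-(b / r)) := by
    have h1 := Real.add_one_le_exp (-(b / r))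
    have h2 : (r : ℝ) * (-(b / r) + 1) = r - b := by field_simp; ring
    nlinarith
  have hΩ' : Ω ≤ r * r * Real.exp (-(b / r)) := by
    have h1 : Real.sqrt Ω ≤ r := by linarith
    calc Ω = Real.sqrt Ω * Real.sqrt Ω := (Real.mul_self_sqrt hΩ).symm
      _ ≤ r * (r * Real.exp (-(b / r))) := by gcongr
      _ = _ := by ring
  have hbase : Ω / (4 * N) ≤ r * Real.exp (-(b / r)) / 4 := by
    calc Ω / (4 * N) ≤ (r * r * Real.exp (-(b / r))) / (4 * r) := by gcongr
      _ = _ := by field_simp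
  have hpow : (r * Real.exp (-(b / r)) / 4) ^ r = (r : ℝ) ^ r / 4 ^ r * Real.exp (-b) := by
    rw [div_pow, mul_pow, ← Real.exp_nat_mul]
    have : (r : ℝ) * -(b / r) = -b := by field_simp
    rw [this]
    ring
  have hfact : (r : ℝ) ^ r / r.factorial ≤ 4 ^ r := by
    calc (r : ℝ) ^ r / r.factorial ≤ Real.exp r := Real.pow_div_factorial_le_exp r hr0.le r
      _ = Real.exp 1 ^ r := by rw [← Real.exp_nat_mul, mul_one]
      _ ≤ 4 ^ r := by gcongr; linarith [Real.exp_one_lt_three]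
  calc t / Real.pi * (Ω / (4 * N)) ^ r / r.factorial
      ≤ ε * Real.exp b * (r * Real.exp (-(b / r)) / 4) ^ r / r.factorial := by gcongr
    _ = ε * ((r : ℝ) ^ r / r.factorial / 4 ^ r) := by
        rw [hpow, Real.exp_neg]
        field_simp
    _ ≤ ε * 1 := by
        gcongr
        exact (div_le_one (by positivity)).mpr hfact
    _ = ε := mul_one ε

theorem epsRank_le_two_pow (K m : ℕ) (hm : m ≤ K) (T : (Fin K → Bool) → ℝ) {ε : ℝ}
    (hε : 0 ≤ ε) : epsRank K m hm T ε ≤ 2 ^ m := by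
  let e : Fin (2 ^ m) ≃ (Fin m → Bool) := (Fintype.equivFinOfCardEq (by simp)).symm
  refine Nat.sInf_le ⟨fun α s => if α = e.symm s then 1 else 0, fun α t =>
    T fun k => Fin.append (e α) t (Fin.cast (Nat.add_sub_cancel' hm).symm k), fun σ => ?_⟩
  simp only [ite_mul, one_mul, zero_mul, Finset.sum_ite_eq', Finset.mem_univ, if_true,
    Equiv.apply_symm_apply]
  have hσ : (fun k => Fin.append (fun i => σ (Fin.castLE hm i))
      (fun i => σ (Fin.cast (Nat.add_sub_cancel' hm) (Fin.natAdd m i)))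
      (Fin.cast (Nat.add_sub_cancel' hm).symm k)) = σ := by
    funext k
    obtain ⟨j, rfl⟩ : ∃ j, Fin.cast (Nat.add_sub_cancel' hm) j = k :=
      ⟨Fin.cast (Nat.add_sub_cancel' hm).symm k, rfl⟩
    induction j using Fin.addCases with
    | left i => exact Fin.append_left _ _ i
    | right i => exact Fin.append_right _ _ i
  rw [hσ, sub_self, abs_zero]
  exact hε

/-- The contribution to a grid point of the binary digits that follow the first `m`. -/
def dyadicTail (m n : ℕ) (s : Fin n → Bool) : ℝ :=
  ∑ k : Fin n, (2 : ℝ) ^ (-((m + k.val : ℕ) + 1 : ℤ)) * bitVal (s k)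

theorem sum_dyadic_eq_add {K m : ℕ} (hm : m ≤ K) (σ : Fin K → Bool) :
    ∑ k : Fin K, (2 : ℝ) ^ (-(k.val + 1 : ℤ)) * bitVal (σ k) =
      dyadicTail 0 m (fun i => σ (Fin.castLE hm i)) +
        dyadicTail m (K - m)
          (fun i => σ (Fin.cast (Nat.add_sub_cancel' hm) (Fin.natAdd m i))) := by
  rw [← (finCongr (Nat.add_sub_cancel' hm)).sum_comp, Fin.sum_univ_add]
  simp only [dyadicTail, zero_add]
  rfl

theorem sum_range_two_zpow (m n : ℕ) :
    ∑ k ∈ Finset.range n, (2 : ℝ) ^ (-((m + k : ℕ) + 1 : ℤ)) =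
      1 / 2 ^ m - 1 / 2 ^ (m + n) := by
  induction n with
  | zero => simp
  | succ n ih =>
    rw [Finset.sum_range_succ, ih, zpow_neg, zpow_add_one₀ two_ne_zero, zpow_natCast,
      ← add_assoc, pow_succ]
    field_simp
    ring

theorem dyadicTail_mem_Icc (m n : ℕ) (s : Fin n → Bool) :
    dyadicTail m n s ∈ Set.Icc (0 : ℝ) (1 / 2 ^ m) := by
  have hbit (b : Bool) : 0 ≤ bitVal b ∧ bitVal b ≤ 1 := by cases b <;> simp [bitVal]
  refine ⟨Finset.sum_nonneg fun k _ => mul_nonneg (by positivity) (hbit _).1, ?_⟩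
  calc dyadicTail m n s ≤ ∑ k : Fin n, (2 : ℝ) ^ (-((m + k.val : ℕ) + 1 : ℤ)) :=
        Finset.sum_le_sum fun k _ => mul_le_of_le_one_right (by positivity) (hbit _).2
    _ = 1 / 2 ^ m - 1 / 2 ^ (m + n) := by rw [← sum_range_two_zpow, Finset.sum_range]
    _ ≤ 1 / 2 ^ m := sub_le_self _ (by positivity)

/-- if `f : [0,1] → ℝ` is the restriction of an `Ω`-bandlimited function
with spectral measure `μ`, `K ≥ 1`, `T` the quantized tensor representation of `f` on
`D_K`, and `ε > 0`, then for every `1 ≤ m ≤ K-1`,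
`r_m^{(ε,∞)}[T] ≤ 1 + ⌈√Ω + 2 log₊(2|μ|/(πε))⌉`. -/
theorem stmt7 (Ω : ℝ) (hΩ : 0 < Ω) (μ : MeasureTheory.SignedMeasure ℝ) (g : ℝ → ℝ)
    (hg : IsBandlimited Ω μ g) (K : ℕ) (hK : 1 ≤ K) (ε : ℝ) (hε : 0 < ε) :
    ∀ m : ℕ, 1 ≤ m → ∀ hmK : m ≤ K - 1,
      epsRank K m (hmK.trans (Nat.sub_le K 1)) (qtt g K) ε ≤
        1 + ⌈Real.sqrt Ω + 2 * max (Real.log (2 * tv μ / (Real.pi * ε))) 0⌉₊ := by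
  intro m _ hmK
  have hm : m ≤ K := hmK.trans (Nat.sub_le K 1)
  set r := 1 + ⌈Real.sqrt Ω + 2 * max (Real.log (2 * tv μ / (Real.pi * ε))) 0⌉₊ with hr
  rcases le_total (2 ^ m) r with hmr | hrm
  · exact (epsRank_le_two_pow K m hm _ hε.le).trans hmr
  have hr0 : r ≠ 0 := by omega
  have hceil : Real.sqrt Ω + 2 * max (Real.log (2 * tv μ / (Real.pi * ε))) 0 ≤ r := by
    refine (Nat.le_ceil _).trans ?_
    exact_mod_cast Nat.le_add_left _ 1
  have hbound := mul_pow_div_factorial_le (N := 2 ^ m) hΩ.le (tv_nonneg μ) hε hr0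
    (by exact_mod_cast hrm) hceil
  set l : ℝ := 1 / (2 * 2 ^ m) with hl
  refine Nat.sInf_le ⟨fun α s => g (dyadicTail 0 m s + l * (1 + chebyshevNode r α)),
    fun α t => (Lagrange.basis Finset.univ (chebyshevNode r) α).eval
      (dyadicTail m (K - m) t / l - 1), fun σ => ?_⟩
  rw [qtt, sum_dyadic_eq_add hm]
  set y := dyadicTail 0 m fun i => σ (Fin.castLE hm i)
  set t : Fin (K - m) → Bool :=
    fun i => σ (Fin.cast (Nat.add_sub_cancel' hm) (Fin.natAdd m i))
  have hl0 : 0 < l := by positivity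
  obtain ⟨hz0, hz1⟩ := dyadicTail_mem_Icc m (K - m) t
  have hl2 : 1 / 2 ^ m = 2 * l := by rw [hl]; field_simp
  have hu : |dyadicTail m (K - m) t / l - 1| ≤ 1 := by
    have h1 : dyadicTail m (K - m) t / l ≤ 2 := by
      rw [div_le_iff₀ hl0, ← hl2]
      exact hz1
    have h2 : 0 ≤ dyadicTail m (K - m) t / l := by positivity
    rw [abs_le]
    constructor <;> linarith
  have h := hg.abs_sub_chebyshev_interpolation_le hr0 y hl0.le hu
  have hz : l * (1 + (dyadicTail m (K - m) t / l - 1)) = dyadicTail m (K - m) t := by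
    field_simp
    ring
  have hΩl : Ω * l / 2 = Ω / (4 * 2 ^ m) := by
    rw [hl]
    field_simp
    norm_num
  rw [hz, hΩl] at h
  exact h.trans hbound
end
end
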